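/- arXiv:0806.0424 — 3 statements merged into one kernel-verified Lean document; each statement's English description precedes it below -/
import Mathlib

section
/- For all integers k ≥ 1, n ≥ k+1, and 1 ≤ l ≤ n−k, the numbers p_{n;≤s}^l satisfy the recurrence p_{n;≤n−k}^l = p_{n;≤n−k+1}^l − Σ_{i=1}^{k} C(n−1,i) · p_{n−i;≤n−k}^l. -/
/-- A parking function of length `n`: a sequence of positive integers whose
nondecreasing rearrangement `b` satisfies `b i ≤ i` (1-indexed). -/
def IsParkingFunction (n : ℕ) (a : Fin n → ℕ) : Prop :=
  (∀ i, 1 ≤ a i) ∧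
  ∃ σ : Equiv.Perm (Fin n), Monotone (a ∘ σ) ∧ ∀ i : Fin n, a (σ i) ≤ (i : ℕ) + 1

/-- A parking function of length `n` with `m ≥ n` parking spaces: entries in `[1,m]`
whose nondecreasing rearrangement `b` satisfies `b i ≤ m - n + i` (1-indexed). -/
def IsParkingFunctionWith (n m : ℕ) (a : Fin n → ℕ) : Prop :=
  (∀ i, 1 ≤ a i ∧ a i ≤ m) ∧
  ∃ σ : Equiv.Perm (Fin n), Monotone (a ∘ σ) ∧ ∀ i : Fin n, a (σ i) ≤ m - n + ((i : ℕ) + 1)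

/-- `pN n` = number of parking functions of length `n` (so `pN n = (n+1)^(n-1)`). -/
noncomputable def pN (n : ℕ) : ℕ := Nat.card {a : Fin n → ℕ // IsParkingFunction n a}

/-- `pWith n m` = `p_{n,m;≤m}`, the number of parking functions of length `n`
with `m` parking spaces. -/
noncomputable def pWith (n m : ℕ) : ℕ := Nat.card {a : Fin n → ℕ // IsParkingFunctionWith n m a}

/-- `pLe n s` = `p_{n;≤s}`, the number of parking functions of length `n`
all of whose entries are at most `s`. -/
noncomputable def pLe (n s : ℕ) : ℕ :=
  Nat.card {a : Fin n → ℕ // IsParkingFunction n a ∧ ∀ i, a i ≤ s}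

/-- `pEq n s` = `p_{n;=s} = p_{n;≤s} - p_{n;≤s-1}` (with `p_{n;≤s} = 0` for `s < 0`). -/
noncomputable def pEq (n s : ℕ) : ℕ := pLe n s - (if s = 0 then 0 else pLe n (s - 1))

/-- `pLeL n s l` = `p_{n;≤s}^l`, the number of parking functions of length `n` with all
entries at most `s` and first entry equal to `l`. -/
noncomputable def pLeL (n s l : ℕ) : ℕ :=
  Nat.card {a : Fin n → ℕ //
    IsParkingFunction n a ∧ (∀ i, a i ≤ s) ∧ (List.ofFn a).head? = some l}

/-- `pL n l` = `p_n^l`, the number of parking functions of length `n` with first entry `l`. -/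
noncomputable def pL (n l : ℕ) : ℕ :=
  Nat.card {a : Fin n → ℕ //
    IsParkingFunction n a ∧ (List.ofFn a).head? = some l}

/-- `pEqL n s l` = `p_{n;=s}^l = p_{n;≤s}^l - p_{n;≤s-1}^l`. -/
noncomputable def pEqL (n s l : ℕ) : ℕ := pLeL n s l - (if s = 0 then 0 else pLeL n (s - 1) l)

/-- Simulate the parking process with `m` spaces: cars arrive in order with the given
preference list, each parks in the first free space among `pref, pref+1, …, m` if any;
returns the number of cars that leave unparked, given the set `occ` of occupied spaces. -/
def flawCount (m : ℕ) : List ℕ → Finset ℕ → ℕ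
  | [], _ => 0
  | p :: rest, occ =>
    match (List.range' p (m + 1 - p)).find? (fun s => decide (s ∉ occ)) with
    | some s => flawCount m rest (insert s occ)
    | none => flawCount m rest occ + 1

/-- `pFlaw n m k` = `p_{n,m;≤m;k}`, the number of `k`-flaw preference sets of length `n`
with `m` parking spaces and all entries in `[1,m]`. -/
noncomputable def pFlaw (n m k : ℕ) : ℕ :=
  Nat.card {a : Fin n → ℕ //
    (∀ i, 1 ≤ a i ∧ a i ≤ m) ∧ flawCount m (List.ofFn a) ∅ = k}

/-- `P(x) = Σ_{n≥0} (n+1)^(n-1) xⁿ/n!` in `ℚ[[x]]`. -/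
noncomputable def Pser : PowerSeries ℚ :=
  PowerSeries.mk fun n => ((n : ℚ) + 1) ^ (n - 1) / n.factorial

/-- `Q_k(x) = Σ_{n≥0} p_{n,n+k;≤n+k} xⁿ/n!` in `ℚ[[x]]`. -/
noncomputable def Qser (k : ℕ) : PowerSeries ℚ :=
  PowerSeries.mk fun n => (pWith n (n + k) : ℚ) / n.factorial

/-- `R_k(x) = Σ_{n≥k} p_{n;≤n-k} xⁿ/n!` in `ℚ[[x]]`. -/
noncomputable def Rser (k : ℕ) : PowerSeries ℚ :=
  PowerSeries.mk fun n => if n < k then 0 else (pLe n (n - k) : ℚ) / n.factorial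

/-- `H_k(x) = Σ_{n≥k} p_{n;=n-k} xⁿ/n!` in `ℚ[[x]]`. -/
noncomputable def Hser (k : ℕ) : PowerSeries ℚ :=
  PowerSeries.mk fun n => if n < k then 0 else (pEq n (n - k) : ℚ) / n.factorial

/-- `T_k(x) = Σ_{n≥k+1} p_n^{n-k} xⁿ/(n-1)!` in `ℚ[[x]]`. -/
noncomputable def Tser (k : ℕ) : PowerSeries ℚ :=
  PowerSeries.mk fun n => if n < k + 1 then 0 else (pL n (n - k) : ℚ) / (n - 1).factorial

/-- `F_{k,s}(x) = Σ_{n≥s+1} p_{n;≤n-k}^{n-s} xⁿ/(n-1)!` in `ℚ[[x]]`. -/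
noncomputable def Fser (k s : ℕ) : PowerSeries ℚ :=
  PowerSeries.mk fun n =>
    if n < s + 1 then 0 else (pLeL n (n - k) (n - s) : ℚ) / (n - 1).factorial

open Finset in
theorem pf_iff (n : ℕ) (a : Fin n → ℕ) : IsParkingFunction n a ↔
    (∀ i, 1 ≤ a i) ∧ ∀ j ≤ n, j ≤ #{i | a i ≤ j} := by
  unfold IsParkingFunction
  refine and_congr_right fun _ => ⟨?_, ?_⟩
  · rintro ⟨σ, -, h⟩ j hj
    have h1 : #(univ.filter fun i : Fin n => (i : ℕ) < j) = j := by
      rw [Fin.card_filter_val_lt]; omega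
    calc j = #((univ.filter fun i : Fin n => (i : ℕ) < j).map σ.toEmbedding) := by
          rw [card_map, h1]
      _ ≤ _ := by
          apply card_le_card
          intro x hx
          simp only [mem_map, mem_filter, mem_univ, true_and] at hx ⊢
          obtain ⟨y, hy, rfl⟩ := hx
          have := h y
          simp only [Equiv.coe_toEmbedding]
          omega
  · intro h
    refine ⟨Tuple.sort a, Tuple.monotone_sort a, fun i => ?_⟩
    by_contra hc
    have h1 := h (i + 1) i.2
    have h2 : #(univ.filter fun x => a x ≤ i + 1)
        ≤ #((univ.filter fun x : Fin n => (x : ℕ) < i).map (Tuple.sort a).toEmbedding) := by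
      apply card_le_card
      intro x hx
      simp only [mem_map, mem_filter, mem_univ, true_and] at hx ⊢
      refine ⟨(Tuple.sort a).symm x, ?_, by simp⟩
      by_contra hlt
      have h3 : i ≤ (Tuple.sort a).symm x := by
        rw [Fin.le_def]; omega
      have h4 := Tuple.monotone_sort a h3
      simp only [Function.comp, Equiv.apply_symm_apply] at h4
      omega
    rw [card_map, Fin.card_filter_val_lt] at h2
    omega

open Finset in
/-- tails with entries in `[1,s]` completing `l` to a parking function -/
def tailSet (ι : Type) [Fintype ι] [DecidableEq ι] (l s M : ℕ) : Finset (ι → ℕ) :=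
  (Fintype.piFinset fun _ => Icc 1 s).filter
    fun b => ∀ j ≤ M, j ≤ #{i | b i ≤ j} + if l ≤ j then 1 else 0

open Finset in
theorem mem_tailSet {ι : Type} [Fintype ι] [DecidableEq ι] {l s M : ℕ} {b : ι → ℕ} :
    b ∈ tailSet ι l s M ↔ (∀ i, 1 ≤ b i ∧ b i ≤ s) ∧
      ∀ j ≤ M, j ≤ #{i | b i ≤ j} + if l ≤ j then 1 else 0 := by
  simp [tailSet, Fintype.mem_piFinset]

open Finset in
theorem card_tailSet_congr {ι κ : Type} [Fintype ι] [DecidableEq ι] [Fintype κ] [DecidableEq κ]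
    (e : ι ≃ κ) (l s M : ℕ) : #(tailSet ι l s M) = #(tailSet κ l s M) := by
  have key : ∀ (b : κ → ℕ) j, #{i | b (e i) ≤ j} = #{i | b i ≤ j} := by
    intro b j
    rw [← card_map e.toEmbedding]
    congr 1
    ext x
    simp only [mem_map, mem_filter, mem_univ, true_and, Equiv.coe_toEmbedding]
    exact ⟨by rintro ⟨y, hy, rfl⟩; exact hy, fun h => ⟨e.symm x, by simpa using h, by simp⟩⟩
  symm
  refine card_bij' (fun b _ => b ∘ e) (fun b _ => b ∘ e.symm) ?_ ?_ ?_ ?_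
  · intro b hb
    rw [mem_tailSet] at hb ⊢
    exact ⟨fun i => hb.1 _, fun j hj => by simpa [key] using hb.2 j hj⟩
  · intro b hb
    rw [mem_tailSet] at hb ⊢
    refine ⟨fun i => hb.1 _, fun j hj => ?_⟩
    rw [← key]
    simpa using hb.2 j hj
  · intro b _; ext; simp
  · intro b _; ext; simp

open Finset in
theorem pLeL_eq (N s l : ℕ) (hl : 1 ≤ l) (hs : l ≤ s) (hN : s ≤ N + 1) :
    pLeL (N + 1) s l = #(tailSet (Fin N) l s s) := by
  have cnt : ∀ (a : Fin (N+1) → ℕ) j, #{i | a i ≤ j} =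
      #{i | Fin.tail a i ≤ j} + if a 0 ≤ j then 1 else 0 := by
    intro a j
    rw [Fin.card_filter_univ_succ]
    simp only [Fin.tail, Function.comp]
    split_ifs <;> rfl
  unfold pLeL
  rw [← Nat.card_eq_finsetCard]
  have key : ∀ a : Fin (N+1) → ℕ, (IsParkingFunction (N+1) a ∧ (∀ i, a i ≤ s) ∧
      (List.ofFn a).head? = some l) ↔ a 0 = l ∧ Fin.tail a ∈ tailSet (Fin N) l s s := by
    intro a
    rw [pf_iff, mem_tailSet]
    simp only [List.ofFn_succ, List.head?_cons, Option.some.injEq]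
    constructor
    · rintro ⟨⟨h1, h2⟩, h3, h4⟩
      refine ⟨h4, fun i => ⟨h1 _, h3 _⟩, fun j hj => ?_⟩
      have := h2 j (by omega)
      rwa [cnt, h4] at this
    · rintro ⟨h4, h1, h2⟩
      have h3 : ∀ i, 1 ≤ a i ∧ a i ≤ s := by
        intro i
        refine Fin.cases ?_ (fun i => h1 i) i
        omega
      refine ⟨⟨fun i => (h3 i).1, fun j hj => ?_⟩, fun i => (h3 i).2, h4⟩
      rcases Nat.lt_or_ge s j with h5 | h5
      · rw [filter_true_of_mem (fun i _ => (h3 i).2.trans h5.le)]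
        simpa using hj
      · rw [cnt, h4]
        exact h2 j h5
  refine Nat.card_congr ⟨fun a => ⟨Fin.tail a.1, ((key a.1).1 a.2).2⟩,
    fun b => ⟨Fin.cons l b.1, (key _).2 ⟨rfl, by simpa using b.2⟩⟩, fun a => ?_, fun b => ?_⟩
  · apply Subtype.ext
    have h := ((key a.1).1 a.2).1
    simp only
    conv_rhs => rw [← Fin.cons_self_tail a.1, h]
  · apply Subtype.ext
    simp

open Finset in
theorem card_fiber (ι : Type) [Fintype ι] [DecidableEq ι] (l m : ℕ) (S : Finset ι) :
    #((tailSet ι l (m+1) m).filter fun b => (univ.filter fun i => b i = m + 1) = S) =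
      #(tailSet {i // i ∉ S} l m m) := by
  have cnt : ∀ (b : ι → ℕ), (∀ i, b i = m + 1 ↔ i ∈ S) → ∀ j ≤ m,
      #{i | b i ≤ j} = #{i : {i // i ∉ S} | b i ≤ j} := by
    intro b hb j hj
    rw [← card_map (Function.Embedding.subtype _)]
    congr 1
    ext x
    simp only [mem_map, mem_filter, mem_univ, true_and, Function.Embedding.subtype_apply,
      Subtype.exists, exists_and_left, exists_prop, exists_eq_right_right]
    constructor
    · intro h
      refine ⟨h, fun hx => ?_⟩
      have := (hb x).2 hx
      omega
    · exact fun h => h.1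
  have hS : ∀ b : ι → ℕ, (univ.filter fun i => b i = m + 1) = S ↔ ∀ i, b i = m + 1 ↔ i ∈ S := by
    intro b
    simp [Finset.ext_iff]
  have hE : ∀ (c : {i // i ∉ S} → ℕ) (x : {i // i ∉ S}),
      (if h : (x : ι) ∈ S then m + 1 else c ⟨x, h⟩) = c x := by
    intro c x
    simp [x.2]
  refine card_bij' (fun b _ => fun i => b i.1)
    (fun c _ => fun i => if h : i ∈ S then m + 1 else c ⟨i, h⟩) ?_ ?_ ?_ ?_
  · intro b hb
    rw [mem_filter, mem_tailSet, hS] at hb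
    obtain ⟨⟨h1, h2⟩, h3⟩ := hb
    rw [mem_tailSet]
    refine ⟨fun i => ⟨(h1 i).1, ?_⟩, fun j hj => ?_⟩
    · have := (h1 i).2
      have h4 := mt (h3 i).1 i.2
      omega
    · rw [← cnt b h3 j hj]; exact h2 j hj
  · intro c hc
    rw [mem_tailSet] at hc
    have h3 : ∀ i, (if h : i ∈ S then m + 1 else c ⟨i, h⟩) = m + 1 ↔ i ∈ S := by
      intro i
      split_ifs with h
      · simp [h]
      · have := (hc.1 ⟨i, h⟩).2
        simp only [h, iff_false]; omega
    rw [mem_filter, mem_tailSet, hS]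
    refine ⟨⟨fun i => ?_, fun j hj => ?_⟩, h3⟩
    · split_ifs with h
      · omega
      · have := hc.1 ⟨i, h⟩
        omega
    · rw [cnt _ h3 j hj]
      simp only [hE]
      exact hc.2 j hj
  · intro b hb
    rw [mem_filter, hS] at hb
    ext i
    split_ifs with h
    · exact ((hb.2 i).2 h).symm
    · rfl
  · intro c hc
    ext i
    exact hE c i

open Finset in
theorem card_split (N l m : ℕ) (hN : m ≤ N) (hl : l ≤ m) :
    #(tailSet (Fin N) l (m+1) (m+1)) =
      ∑ i ∈ range (N + 1), N.choose i * #(tailSet (Fin (N - i)) l m m) := by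
  have h0 : tailSet (Fin N) l (m+1) (m+1) = tailSet (Fin N) l (m+1) m := by
    ext b
    rw [mem_tailSet, mem_tailSet]
    refine and_congr_right fun h1 => ⟨fun h j hj => h j (by omega), fun h j hj => ?_⟩
    rcases Nat.lt_or_ge m j with h2 | h2
    · have : j = m + 1 := by omega
      subst this
      rw [filter_true_of_mem (fun i _ => (h1 i).2), if_pos (by omega)]
      simp; omega
    · exact h j h2
  rw [h0, card_eq_sum_card_fiberwise (f := fun b => univ.filter fun i => b i = m + 1)
    (t := (univ : Finset (Fin N)).powerset) (fun _ _ => by simp)]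
  have h1 : ∀ S ∈ (univ : Finset (Fin N)).powerset,
      #((tailSet (Fin N) l (m+1) m).filter fun b => (univ.filter fun i => b i = m + 1) = S) =
      (fun i => #(tailSet (Fin (N - i)) l m m)) (#S) := by
    intro S _
    rw [card_fiber]
    apply card_tailSet_congr
    apply Fintype.equivFinOfCardEq
    simp
  rw [sum_congr rfl h1, sum_powerset_apply_card (fun i => #(tailSet (Fin (N - i)) l m m))]
  simp

open Finset in
theorem tailSet_empty (N l m : ℕ) (h : N + 1 < m) : #(tailSet (Fin N) l m m) = 0 := by
  rw [card_eq_zero, eq_empty_iff_forall_notMem]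
  intro b hb
  rw [mem_tailSet] at hb
  have h1 := hb.2 m le_rfl
  have h2 : #{i | b i ≤ m} ≤ N := (card_le_univ _).trans (by simp)
  split_ifs at h1 <;> omega

/-- `p_{n;≤n-k}^l = p_{n;≤n-k+1}^l - Σ_{i=1}^k C(n-1,i) p_{n-i;≤n-k}^l`. -/
theorem stmt10 (k n l : ℕ) (hk : 1 ≤ k) (hn : k + 1 ≤ n) (hl1 : 1 ≤ l) (hl2 : l ≤ n - k) :
    (pLeL n (n - k) l : ℤ) =
      (pLeL n (n - k + 1) l : ℤ) -
        ∑ i ∈ Finset.Icc 1 k, ((n - 1).choose i : ℤ) * (pLeL (n - i) (n - k) l : ℤ) := by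
  obtain ⟨N, rfl⟩ : ∃ N, n = N + 1 := ⟨n - 1, by omega⟩
  obtain ⟨m, hm⟩ : ∃ m, m = N + 1 - k := ⟨_, rfl⟩
  rw [← hm] at hl2 ⊢
  have hs := card_split N l m (by omega) hl2
  have hsub : Finset.range (k + 1) ⊆ Finset.range (N + 1) := by
    intro x; simp only [Finset.mem_range]; omega
  rw [← Finset.sum_subset hsub, Finset.range_eq_Ico, Finset.sum_eq_sum_Ico_succ_bot (by omega)] at hs
  · rw [pLeL_eq N m l hl1 hl2 (by omega), pLeL_eq N (m+1) l hl1 (by omega) (by omega), hs]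
    have h2 : ∀ i ∈ Finset.Icc 1 k, ((N + 1 - 1).choose i : ℤ) * (pLeL (N + 1 - i) m l : ℤ) =
        ((N.choose i * (tailSet (Fin (N - i)) l m m).card : ℕ) : ℤ) := by
      intro i hi
      rw [Finset.mem_Icc] at hi
      rw [show N + 1 - i = (N - i) + 1 by omega, pLeL_eq (N - i) m l hl1 hl2 (by omega)]
      simp
    rw [Finset.sum_congr rfl h2]
    have h3 : Finset.Ico (0 + 1) (k + 1) = Finset.Icc 1 k := by
      ext; simp
    rw [h3]
    push_cast
    simp
  · intro i hi hi'
    simp only [Finset.mem_range] at hi hi'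
    rw [tailSet_empty _ _ _ (by omega), mul_zero]
end

section
/- For all integers k ≥ 1, n ≥ k+1, and 1 ≤ l ≤ n−k, the numbers p_{n;≤s}^l satisfy the recurrence p_{n;≤n−k}^l = p_n^l − Σ_{i=1}^{k} C(n−1,i) · (k−i+1) · (k+1)^{i−1} · p_{n−i;≤n−k}^l, where p_n^l = p_{n;≤n}^l. -/
namespace PF11

/-- Tail condition for a parking function with first entry `l` and entries at most `s`. -/
def G {α : Type} [Fintype α] (l s : ℕ) (g : α → ℕ) : Prop :=
  (∀ x, 1 ≤ g x ∧ g x ≤ s) ∧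
    ∀ t ≤ s, t ≤ (Finset.univ.filter (fun x => g x ≤ t)).card + if l ≤ t then 1 else 0

/-- Number of good tails of length `m`. -/
noncomputable def b (l m s : ℕ) : ℕ := Nat.card {g : Fin m → ℕ // G l s g}

theorem finite_G {α : Type} [Fintype α] (l s : ℕ) : Finite {g : α → ℕ // G l s g} := by
  classical
  have : Set.Finite {g : α → ℕ | G l s g} := by
    apply Set.Finite.subset (Set.Finite.pi' (fun _ : α => Set.finite_Iic s))
    intro g hg x
    exact (hg.1 x).2
  exact this.to_subtype

theorem card_G {α : Type} [Fintype α] (l s : ℕ) :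
    Nat.card {g : α → ℕ // G l s g} = b l (Fintype.card α) s := by
  classical
  unfold b
  let e := Fintype.equivFin α
  apply Nat.card_congr
  refine (Equiv.arrowCongr e (Equiv.refl ℕ)).subtypeEquiv ?_
  intro g
  unfold G
  have h2 : ∀ t, (Finset.univ.filter (fun x => g x ≤ t)).card =
      (Finset.univ.filter (fun y => g (e.symm y) ≤ t)).card := by
    intro t
    apply Finset.card_equiv e
    intro i
    simp
  simp only [Equiv.arrowCongr_apply, Equiv.coe_refl, Function.comp, id, h2]
  constructor
  · rintro ⟨h, h'⟩
    exact ⟨fun x => h _, h'⟩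
  · rintro ⟨h, h'⟩
    refine ⟨fun x => ?_, h'⟩
    simpa using h (e x)

theorem b_zero (l m s : ℕ) (h : m + 1 < s) : b l m s = 0 := by
  unfold b
  have : IsEmpty {g : Fin m → ℕ // G l s g} := by
    refine ⟨fun g => ?_⟩
    have h1 := g.2.2 s le_rfl
    have h2 : (Finset.univ.filter (fun x => g.1 x ≤ s)).card ≤ m := by
      simpa using Finset.card_le_univ (Finset.univ.filter (fun x => g.1 x ≤ s))
    split_ifs at h1 <;> omega
  exact Nat.card_of_isEmpty

/-- Extend by the value `r+1` on `S`. -/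
def ext {α : Type} [DecidableEq α] (r : ℕ) (S : Finset α) (h : {x // x ∉ S} → ℕ) (x : α) : ℕ :=
  if hx : x ∈ S then r + 1 else h ⟨x, hx⟩

theorem ext_card {α : Type} [Fintype α] [DecidableEq α] (r : ℕ) (S : Finset α)
    (h : {x // x ∉ S} → ℕ) (t : ℕ) (ht : t ≤ r) :
    (Finset.univ.filter (fun x => ext r S h x ≤ t)).card =
      (Finset.univ.filter (fun x => h x ≤ t)).card := by
  symm
  apply Finset.card_bij (fun x _ => x.1)
  · intro x hx
    simp only [Finset.mem_filter, Finset.mem_univ, true_and] at hx ⊢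
    simpa [ext, x.2] using hx
  · intro x _ y _ hxy
    exact Subtype.ext hxy
  · intro x hx
    simp only [Finset.mem_filter, Finset.mem_univ, true_and] at hx
    unfold ext at hx
    split_ifs at hx with hS
    · omega
    · exact ⟨⟨x, hS⟩, by simpa using hx, rfl⟩

theorem ext_G {α : Type} [Fintype α] [DecidableEq α] (l r : ℕ) (S : Finset α)
    (h : {x // x ∉ S} → ℕ) (hl : l ≤ r) (hr : r ≤ Fintype.card α) (hG : G l r h) :
    G l (r + 1) (ext r S h) := by
  have hb : ∀ x, 1 ≤ ext r S h x ∧ ext r S h x ≤ r + 1 := by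
    intro x
    unfold ext
    split_ifs with hx
    · omega
    · have := hG.1 ⟨x, hx⟩
      omega
  refine ⟨hb, fun t ht => ?_⟩
  rcases Nat.lt_or_ge r t with h1 | h1
  · have : t = r + 1 := by omega
    subst this
    have : (Finset.univ.filter (fun x => ext r S h x ≤ r + 1)) = Finset.univ := by
      apply Finset.filter_true_of_mem
      intro x _
      exact (hb x).2
    rw [this, Finset.card_univ, if_pos (by omega)]
    omega
  · rw [ext_card r S h t h1]
    exact hG.2 t h1

theorem rec_b (l m r : ℕ) (hl : l ≤ r) (hr : r ≤ m) :
    b l m (r + 1) = ∑ j ∈ Finset.range (m + 1), m.choose j * b l (m - j) r := by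
  classical
  let φ : (Σ S : Finset (Fin m), {h : {x // x ∉ S} → ℕ // G l r h}) →
      {g : Fin m → ℕ // G l (r + 1) g} :=
    fun p => ⟨ext r p.1 p.2.1, ext_G l r p.1 p.2.1 hl (by simpa using hr) p.2.2⟩
  have hφ : Function.Bijective φ := by
    constructor
    · rintro ⟨S, h, hh⟩ ⟨S', h', hh'⟩ heq
      have heq' : ext r S h = ext r S' h' := congrArg Subtype.val heq
      have key : ∀ (T : Finset (Fin m)) (k : {x // x ∉ T} → ℕ), G l r k →
          ∀ x, x ∈ T ↔ ext r T k x = r + 1 := by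
        intro T k hk x
        unfold ext
        split_ifs with hx
        · simp [hx]
        · have := (hk.1 ⟨x, hx⟩).2
          simp only [hx, false_iff]
          omega
      have hS : S = S' := by
        ext x
        rw [key S h hh, key S' h' hh', heq']
      subst hS
      have : h = h' := by
        funext x
        have := congrFun heq' x.1
        simpa [ext, x.2] using this
      subst this
      rfl
    · rintro ⟨g, hg⟩
      let S : Finset (Fin m) := Finset.univ.filter (fun x => g x = r + 1)
      have he : ext r S (fun x => g x.1) = g := by
        funext x
        unfold ext
        split_ifs with hx
        · simp [S] at hx
          exact hx.symm
        · rfl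
      refine ⟨⟨S, fun x => g x.1, ?_, ?_⟩, ?_⟩
      · intro x
        have h1 := hg.1 x.1
        have h2 := x.2
        simp only [S, Finset.mem_filter, Finset.mem_univ, true_and] at h2
        refine ⟨h1.1, ?_⟩
        change g x.1 ≤ r
        omega
      · intro t ht
        rw [← ext_card r S (fun x => g x.1) t ht, he]
        exact hg.2 t (by omega)
      · exact Subtype.ext he
  have h1 : b l m (r + 1) = ∑ S : Finset (Fin m), b l (m - S.card) r := by
    unfold b
    rw [← Nat.card_congr (Equiv.ofBijective φ hφ)]
    have : ∀ S : Finset (Fin m), Finite {h : {x // x ∉ S} → ℕ // G l r h} := fun S => finite_G l r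
    rw [Nat.card_sigma]
    apply Finset.sum_congr rfl
    intro S _
    rw [card_G]
    unfold b
    have : Fintype.card {x // x ∉ S} = m - S.card := by
      simp [Fintype.card_subtype_compl]
    rw [this]
  rw [h1, ← Finset.powerset_univ, Finset.sum_powerset_apply_card (fun j => b l (m - j) r)]
  simp

/-- The coefficients. -/
def F (i k : ℕ) : ℤ := ((k : ℤ) + 1) ^ i - i * ((k : ℤ) + 1) ^ (i - 1)

theorem F_self (k : ℕ) : F (k + 1) k = 0 := by
  unfold F
  push_cast
  simp [pow_succ]
  ring

theorem F_sum (r k : ℕ) :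
    ∑ i ∈ Finset.range (r + 1), (r.choose i : ℤ) * F i k = F r (k + 1) := by
  unfold F
  push_cast
  generalize ((k : ℤ) + 1) = x
  simp only [mul_sub, Finset.sum_sub_distrib]
  congr 1
  · rw [add_pow]
    apply Finset.sum_congr rfl
    intro i _
    simp [mul_comm]
  · rcases r with _ | r
    · simp
    · rw [Finset.sum_range_succ']
      simp only [Nat.add_sub_cancel]
      rw [add_pow, Finset.mul_sum]
      simp only [Nat.cast_zero, zero_mul, mul_zero, add_zero]
      apply Finset.sum_congr rfl
      intro i _
      have h := Nat.add_one_mul_choose_eq r i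
      have h' : ((r : ℤ) + 1) * (r.choose i) = ((r + 1).choose (i + 1)) * ((i : ℤ) + 1) := by
        exact_mod_cast h
      push_cast
      simp only [one_pow, mul_one]
      linear_combination (-(x ^ i)) * h'

theorem main_b (l N k : ℕ) (hl : 1 ≤ l) (hk : k + l ≤ N + 1) :
    (b l N (N + 1) : ℤ) =
      ∑ i ∈ Finset.range (k + 1), (N.choose i : ℤ) * F i k * (b l (N - i) (N + 1 - k) : ℤ) := by
  induction k with
  | zero => simp [F]
  | succ k ih =>
    rw [ih (by omega)]
    have h1 : ∀ i ∈ Finset.range (k + 1),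
        (N.choose i : ℤ) * F i k * (b l (N - i) (N + 1 - k) : ℤ) =
        ∑ j ∈ Finset.range (k + 2 - i), (N.choose i : ℤ) * F i k *
          (((N - i).choose j : ℤ) * (b l (N - i - j) (N - k) : ℤ)) := by
      intro i hi
      rw [Finset.mem_range] at hi
      rw [← Finset.mul_sum]
      congr 1
      have e : N + 1 - k = (N - k) + 1 := by omega
      rw [e, rec_b l (N - i) (N - k) (by omega) (by omega)]
      push_cast
      symm
      apply Finset.sum_subset
      · intro j hj
        rw [Finset.mem_range] at hj ⊢
        omega
      · intro j hj hj'
        rw [Finset.mem_range] at hj hj'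
        rw [b_zero l (N - i - j) (N - k) (by omega)]
        simp
    rw [Finset.sum_congr rfl h1]
    have h2 := Finset.sum_range_succ (fun i => ∑ j ∈ Finset.range (k + 2 - i),
      (N.choose i : ℤ) * F i k *
          (((N - i).choose j : ℤ) * (b l (N - i - j) (N - k) : ℤ))) (k + 1)
    simp only [F_self, mul_zero, zero_mul, Finset.sum_const_zero, add_zero] at h2
    rw [← h2, ← Finset.sum_range_diag_flip (k + 2) (fun i j => (N.choose i : ℤ) * F i k *
          (((N - i).choose j : ℤ) * (b l (N - i - j) (N - k) : ℤ)))]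
    apply Finset.sum_congr rfl
    intro r hr
    rw [Finset.mem_range] at hr
    rw [← F_sum, Finset.mul_sum, Finset.sum_mul]
    apply Finset.sum_congr rfl
    intro i hi
    rw [Finset.mem_range] at hi
    have e1 : N - i - (r - i) = N - r := by omega
    have e2 : N + 1 - (k + 1) = N - k := by omega
    rw [e1, e2]
    have h3 : (N.choose r : ℤ) * r.choose i = N.choose i * (N - i).choose (r - i) := by
      exact_mod_cast Nat.choose_mul (n := N) (k := r) (s := i) (by omega)
    linear_combination (-(F i k * (b l (N - r) (N - k) : ℤ))) * h3

theorem pf_iff (n s : ℕ) (hs : s ≤ n) (a : Fin n → ℕ) :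
    (IsParkingFunction n a ∧ ∀ i, a i ≤ s) ↔
      (∀ i, 1 ≤ a i ∧ a i ≤ s) ∧
        ∀ t ≤ s, t ≤ (Finset.univ.filter (fun x => a x ≤ t)).card := by
  constructor
  · rintro ⟨⟨h1, σ, hm, hσ⟩, h2⟩
    refine ⟨fun i => ⟨h1 i, h2 i⟩, fun t ht => ?_⟩
    have hc : (Finset.univ.filter (fun i : Fin n => (i : ℕ) < t)).card = t := by
      rw [Fin.card_filter_val_lt]
      omega
    calc t = (Finset.univ.filter (fun i : Fin n => (i : ℕ) < t)).card := hc.symm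
      _ ≤ _ := by
        apply Finset.card_le_card_of_injOn σ
        · intro i hi
          simp only [Finset.coe_filter, Finset.mem_univ, true_and, Set.mem_setOf_eq] at hi ⊢
          have := hσ i
          omega
        · exact σ.injective.injOn
  · rintro ⟨h1, h2⟩
    refine ⟨⟨fun i => (h1 i).1, Tuple.sort a, Tuple.monotone_sort a, fun i => ?_⟩,
      fun i => (h1 i).2⟩
    by_contra! hc
    have hb := (h1 (Tuple.sort a i)).2
    have h3 := h2 ((i : ℕ) + 1) (by omega)
    have h4 : (Finset.univ.filter (fun x => a x ≤ (i : ℕ) + 1)).card ≤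
        (Finset.univ.filter (fun j : Fin n => (j : ℕ) < i)).card := by
      apply Finset.card_le_card_of_injOn (Tuple.sort a).symm
      · intro j hj
        simp only [Finset.coe_filter, Finset.mem_univ, true_and, Set.mem_setOf_eq] at hj ⊢
        by_contra! hij
        have := Tuple.monotone_sort a (Fin.le_def.mpr hij)
        simp at this
        omega
      · exact (Tuple.sort a).symm.injective.injOn
    rw [Fin.card_filter_val_lt] at h4
    omega

theorem pLeL_eq (N s l : ℕ) (hl : 1 ≤ l) (hls : l ≤ s) (hs : s ≤ N + 1) :
    pLeL (N + 1) s l = b l N s := by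
  unfold pLeL b
  have hc : ∀ (g : Fin N → ℕ) (t : ℕ),
      (Finset.univ.filter (fun x => (Fin.cons l g : Fin (N + 1) → ℕ) x ≤ t)).card =
      (Finset.univ.filter (fun x => g x ≤ t)).card + if l ≤ t then 1 else 0 := by
    intro g t
    rw [Finset.card_filter, Finset.card_filter, Fin.sum_univ_succ]
    simp [add_comm]
  have hG : ∀ g : Fin N → ℕ, G l s g ↔
      (IsParkingFunction (N + 1) (Fin.cons l g : Fin (N + 1) → ℕ) ∧
        ∀ i, (Fin.cons l g : Fin (N + 1) → ℕ) i ≤ s) := by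
    intro g
    rw [pf_iff _ _ hs]
    simp only [hc, G, Fin.forall_fin_succ, Fin.cons_zero, Fin.cons_succ]
    tauto
  symm
  apply Nat.card_congr
  refine Equiv.ofBijective (fun g => ⟨Fin.cons l g.1, ((hG g.1).1 g.2).1, ((hG g.1).1 g.2).2,
    by simp [List.ofFn_succ]⟩) ⟨?_, ?_⟩
  · intro g g' h
    have := congrArg Subtype.val h
    exact Subtype.ext (Fin.cons_right_injective (α := fun _ => ℕ) l this)
  · rintro ⟨a, h1, h2, h3⟩
    have h0 : a 0 = l := by simpa [List.ofFn_succ] using h3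
    have ha : (Fin.cons l (Fin.tail a) : Fin (N + 1) → ℕ) = a := by
      rw [← h0]
      exact Fin.cons_self_tail a
    exact ⟨⟨Fin.tail a, (hG _).2 (by rw [ha]; exact ⟨h1, h2⟩)⟩, Subtype.ext ha⟩

theorem pL_eq (n l : ℕ) : pL n l = pLeL n n l := by
  unfold pL pLeL
  apply Nat.card_congr
  apply Equiv.subtypeEquivRight
  intro a
  constructor
  · rintro ⟨h, h'⟩
    refine ⟨h, fun i => ?_, h'⟩
    obtain ⟨_, σ, _, hσ⟩ := h
    have := hσ (σ.symm i)
    have h2 := (σ.symm i).2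
    simp at this
    omega
  · rintro ⟨h, _, h'⟩
    exact ⟨h, h'⟩

end PF11

/-- `p_{n;≤n-k}^l = p_n^l - Σ_{i=1}^k C(n-1,i)(k-i+1)(k+1)^{i-1} p_{n-i;≤n-k}^l`. -/
theorem stmt11 (k n l : ℕ) (hk : 1 ≤ k) (hn : k + 1 ≤ n) (hl1 : 1 ≤ l) (hl2 : l ≤ n - k) :
    (pLeL n (n - k) l : ℤ) =
      (pL n l : ℤ) -
        ∑ i ∈ Finset.Icc 1 k,
          ((n - 1).choose i : ℤ) * ((k : ℤ) - i + 1) * ((k : ℤ) + 1) ^ (i - 1) *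
            (pLeL (n - i) (n - k) l : ℤ) := by
  obtain ⟨N, rfl⟩ : ∃ N, n = N + 1 := ⟨n - 1, by omega⟩
  rw [PF11.pL_eq, PF11.pLeL_eq N _ l hl1 hl2 (by omega),
    PF11.pLeL_eq N _ l hl1 (by omega) le_rfl, PF11.main_b l N k hl1 (by omega),
    Finset.sum_range_succ', eq_sub_iff_add_eq, add_comm]
  congr 1
  · rw [Finset.range_eq_Ico, Finset.sum_Ico_add' (fun i => (N.choose i : ℤ) * PF11.F i k *
      (PF11.b l (N - i) (N + 1 - k) : ℤ)) 0 k 1]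
    have : Finset.Ico (0 + 1) (k + 1) = Finset.Icc 1 k := by
      ext i
      simp only [Finset.mem_Ico, Finset.mem_Icc]
      omega
    rw [this]
    apply Finset.sum_congr rfl
    intro i hi
    rw [Finset.mem_Icc] at hi
    have e : N + 1 - i = (N - i) + 1 := by omega
    rw [e, PF11.pLeL_eq (N - i) _ l hl1 hl2 (by omega)]
    obtain ⟨j, rfl⟩ : ∃ j, i = j + 1 := ⟨i - 1, by omega⟩
    simp only [PF11.F, Nat.add_sub_cancel]
    push_cast
    ring
  · simp [PF11.F]
end

section
/- For every integer k ≥ 0, the formal power series identity Q_k(x) = P(x)^{k+1} holds in ℚ[[x]]; equivalently, for all n ≥ 0 and k ≥ 0, p_{n,n+k;≤n+k}/n! equals the coefficient of x^n in P(x)^{k+1}. -/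
open Finset in
/-- Counting form of the (0-indexed) parking condition with slack `c`. -/
def PFc (ι : Type) [Fintype ι] (c : ℕ) (v : ι → ℕ) : Prop :=
  ∀ i < Fintype.card ι, i < (Finset.univ.filter fun x => v x < c + i).card

/-- Number of functions satisfying `PFc`. -/
noncomputable def NPF (ι : Type) [Fintype ι] (c : ℕ) : ℕ :=
  Nat.card {v : ι → ℕ // PFc ι c v}

theorem PFc_lt {ι : Type} [Fintype ι] {c : ℕ} {v : ι → ℕ} (h : PFc ι c v) (x : ι) :
    v x < c + Fintype.card ι := by
  have hpos : 0 < Fintype.card ι := Fintype.card_pos_iff.mpr ⟨x⟩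
  have h1 := h (Fintype.card ι - 1) (by omega)
  have h2 : (Finset.univ.filter fun x => v x < c + (Fintype.card ι - 1)) = Finset.univ := by
    apply Finset.eq_univ_of_card
    have := Finset.card_le_univ (Finset.univ.filter fun x => v x < c + (Fintype.card ι - 1))
    omega
  have h3 := Finset.mem_univ x
  rw [← h2, Finset.mem_filter] at h3
  omega

instance PFc_finite (ι : Type) [Fintype ι] (c : ℕ) : Finite {v : ι → ℕ // PFc ι c v} := by
  classical
  let f : {v : ι → ℕ // PFc ι c v} → (ι → Fin (c + Fintype.card ι)) :=
    fun v x => ⟨v.1 x, PFc_lt v.2 x⟩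
  apply Finite.of_injective f
  intro v w h
  ext x
  have := congrFun h x
  simpa [f] using this

theorem PFc_comp {ι κ : Type} [Fintype ι] [Fintype κ] (e : ι ≃ κ) (c : ℕ) (v : κ → ℕ) :
    PFc ι c (v ∘ e) ↔ PFc κ c v := by
  have hc : Fintype.card ι = Fintype.card κ := Fintype.card_congr e
  have : ∀ i, (Finset.univ.filter fun x => (v ∘ e) x < c + i).card =
      (Finset.univ.filter fun x => v x < c + i).card := by
    intro i
    apply Finset.card_equiv e
    intro x
    simp
  unfold PFc
  simp only [this, hc]

theorem NPF_congr {ι κ : Type} [Fintype ι] [Fintype κ] (e : ι ≃ κ) (c : ℕ) :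
    NPF ι c = NPF κ c := by
  apply Nat.card_congr
  exact (Equiv.arrowCongr e (Equiv.refl ℕ)).subtypeEquiv (fun v => by
    rw [← PFc_comp e]
    simp [Equiv.arrowCongr, Function.comp_assoc])

theorem NPF_eq {ι : Type} [Fintype ι] (c : ℕ) :
    NPF ι c = NPF (Fin (Fintype.card ι)) c :=
  NPF_congr (Fintype.equivFin ι) c

theorem PFc_split {ι : Type} [Fintype ι] [DecidableEq ι] (c : ℕ) (T : Finset ι) (v : ι → ℕ)
    (hT : ∀ x, v x = 0 ↔ x ∈ T) :
    PFc ι (c + 1) v ↔ PFc {x // x ∉ T} (c + T.card) (fun x => v x - 1) := by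
  have hcard : Fintype.card {x // x ∉ T} + T.card = Fintype.card ι := by
    have h2 := Finset.card_le_univ T
    have h3 : Fintype.card {x // x ∉ T} = Fintype.card ι - T.card := by simp
    omega
  have key : ∀ i, (Finset.univ.filter fun x => v x < c + 1 + (i + T.card)).card =
      (Finset.univ.filter fun x : {x // x ∉ T} => v x - 1 < c + T.card + i).card + T.card := by
    intro i
    have : (Finset.univ.filter fun x => v x < c + 1 + (i + T.card)) =
      ((Finset.univ.filter fun x : {x // x ∉ T} => v x - 1 < c + T.card + i).map
        (Function.Embedding.subtype _)) ∪ T := by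
      ext x
      have := hT x
      simp
      by_cases hx : x ∈ T <;> simp [hx] at this ⊢ <;> omega
    rw [this, Finset.card_union_of_disjoint, Finset.card_map]
    rw [Finset.disjoint_left]
    intro x hx
    simp at hx
    exact hx.2
  constructor
  · intro h i hi
    have h1 := h (i + T.card) (by omega)
    rw [key] at h1
    exact Nat.lt_of_add_lt_add_right h1
  · intro h i hi
    by_cases hiT : i < T.card
    · refine lt_of_lt_of_le hiT (Finset.card_le_card ?_)
      intro x hx
      have := (hT x).2 hx
      simp
      omega
    · obtain ⟨j, rfl⟩ : ∃ j, i = j + T.card := ⟨i - T.card, by omega⟩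
      rw [key]
      exact Nat.add_lt_add_right (h j (by omega)) _

/-- Decompose by the zero set. -/
noncomputable def splitEquiv (ι : Type) [Fintype ι] [DecidableEq ι] (c : ℕ) :
    {v : ι → ℕ // PFc ι (c + 1) v} ≃
      Σ T : Finset ι, {w : {x // x ∉ T} → ℕ // PFc {x // x ∉ T} (c + T.card) w} where
  toFun v := ⟨Finset.univ.filter fun x => v.1 x = 0, fun x => v.1 x - 1,
    (PFc_split c _ v.1 (by simp)).1 v.2⟩
  invFun p := ⟨fun x => if h : x ∈ p.1 then 0 else p.2.1 ⟨x, h⟩ + 1, by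
    refine (PFc_split c p.1 _ ?_).2 ?_
    · intro x
      by_cases h : x ∈ p.1 <;> simp [h]
    · convert p.2.2 using 1
      ext x
      simp [x.2]⟩
  left_inv v := by
    ext x
    by_cases h : v.1 x = 0 <;> simp [h]
    omega
  right_inv p := by
    obtain ⟨T, w, hw⟩ := p
    have hS : (Finset.univ.filter fun x =>
        (if h : x ∈ T then 0 else w ⟨x, h⟩ + 1) = 0) = T := by
      ext x
      by_cases h : x ∈ T <;> simp [h]
    have gen : ∀ (S : Finset ι) (u : {x // x ∉ S} → ℕ) (hu : PFc {x // x ∉ S} (c + S.card) u),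
        S = T → (∀ x (h : x ∉ S) (h' : x ∉ T), u ⟨x, h⟩ = w ⟨x, h'⟩) →
        (⟨S, u, hu⟩ : Σ T : Finset ι, {w : {x // x ∉ T} → ℕ // PFc {x // x ∉ T} (c + T.card) w})
          = ⟨T, w, hw⟩ := by
      intro S u hu h1 h2
      subst h1
      have : u = w := by
        ext x
        exact h2 x.1 x.2 x.2
      subst this
      rfl
    apply gen
    · exact hS
    · intro x h h'
      simp [h']

theorem NPF_rec (n c : ℕ) :
    NPF (Fin n) (c + 1) =
      ∑ j ∈ Finset.range (n + 1), n.choose j * NPF (Fin (n - j)) (c + j) := by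
  have h : NPF (Fin n) (c + 1) = ∑ T : Finset (Fin n), NPF (Fin (n - T.card)) (c + T.card) := by
    unfold NPF
    rw [Nat.card_congr (splitEquiv (Fin n) c), Nat.card_sigma]
    apply Finset.sum_congr rfl
    intro T _
    change NPF _ _ = NPF _ _
    have hcard : Fintype.card {x // x ∉ T} = n - T.card := by
      simp
    rw [NPF_eq, hcard]
  rw [h]
  have := Finset.sum_powerset_apply_card (fun j => NPF (Fin (n - j)) (c + j))
    (x := (Finset.univ : Finset (Fin n)))
  simpa using this

theorem NPF_zero (n : ℕ) : NPF (Fin n) 0 = if n = 0 then 1 else 0 := by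
  unfold NPF
  split_ifs with h
  · subst h
    have : Unique {v : Fin 0 → ℕ // PFc (Fin 0) 0 v} :=
      { default := ⟨fun _ => 0, by intro i hi; simp at hi⟩
        uniq := fun v => by ext x; exact x.elim0 }
    exact Nat.card_unique
  · have : IsEmpty {v : Fin n → ℕ // PFc (Fin n) 0 v} := by
      constructor
      rintro ⟨v, hv⟩
      have := hv 0 (by simp; omega)
      simp at this
    exact Nat.card_of_isEmpty

theorem isPF_iff (n k : ℕ) (a : Fin n → ℕ) :
    IsParkingFunctionWith n (n + k) a ↔
      (∀ i, 1 ≤ a i) ∧ PFc (Fin n) (k + 1) (fun x => a x - 1) := by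
  constructor
  · rintro ⟨h1, σ, hm, hσ⟩
    refine ⟨fun i => (h1 i).1, ?_⟩
    intro i hi
    rw [Fintype.card_fin] at hi
    have : ((Finset.Iic (⟨i, hi⟩ : Fin n)).map σ.toEmbedding).card = i + 1 := by simp
    have hle : (Finset.Iic (⟨i, hi⟩ : Fin n)).map σ.toEmbedding ⊆
        Finset.univ.filter fun x => a x - 1 < k + 1 + i := by
      intro x hx
      rw [Finset.mem_map] at hx
      obtain ⟨y, hy, rfl⟩ := hx
      have h2 := hσ y
      have h3 : (y : ℕ) ≤ i := by simpa [Fin.le_def] using hy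
      simp
      omega
    have h7 := Finset.card_le_card hle
    rw [this] at h7
    exact h7
  · rintro ⟨h1, h⟩
    have hs : ∀ i : Fin n, a (Tuple.sort a i) ≤ n + k - n + ((i : ℕ) + 1) := by
      intro i
      by_contra hcon
      have h2 := h i (by simp)
      have hle : (Finset.univ.filter fun x => a x - 1 < k + 1 + i) ⊆
          (Finset.Iio i).map (Tuple.sort a).toEmbedding := by
        intro x hx
        rw [Finset.mem_map]
        refine ⟨(Tuple.sort a).symm x, ?_, by simp⟩
        rw [Finset.mem_Iio]
        by_contra hlt
        have h3 := Tuple.monotone_sort a (not_lt.mp hlt)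
        simp at h3 hx
        omega
      have h6 := Finset.card_le_card hle
      rw [Finset.card_map, Fin.card_Iio] at h6
      exact absurd h2 (not_lt.mpr h6)
    refine ⟨fun i => ⟨h1 i, ?_⟩, Tuple.sort a, Tuple.monotone_sort a, hs⟩
    have h4 := hs ((Tuple.sort a).symm i)
    have h5 := ((Tuple.sort a).symm i).2
    simp at h4
    omega

theorem pWith_eq (n k : ℕ) : pWith n (n + k) = NPF (Fin n) (k + 1) := by
  apply Nat.card_congr
  exact
  { toFun := fun a => ⟨fun x => a.1 x - 1, ((isPF_iff n k a.1).1 a.2).2⟩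
    invFun := fun v => ⟨fun x => v.1 x + 1, (isPF_iff n k _).2 ⟨by simp, by simpa using v.2⟩⟩
    left_inv := fun a => by
      ext x
      have := ((isPF_iff n k a.1).1 a.2).1 x
      simp
      omega
    right_inv := fun v => by
      ext x
      simp }

/-- The recurrence satisfied by all our double sequences. -/
def RecF (F : ℕ → ℕ → ℚ) : Prop :=
  ∀ n c, F n (c + 1) =
    ∑ p ∈ Finset.HasAntidiagonal.antidiagonal n, (1 / (p.1.factorial : ℚ)) * F p.2 (c + p.1)

theorem RecF_unique {F G : ℕ → ℕ → ℚ} (hF : RecF F) (hG : RecF G)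
    (h0 : ∀ n, F n 0 = G n 0) : ∀ n c, F n c = G n c := by
  intro n
  induction n using Nat.strong_induction_on with
  | _ n ih =>
    intro c
    induction c with
    | zero => exact h0 n
    | succ c ihc =>
      rw [hF, hG]
      apply Finset.sum_congr rfl
      rintro ⟨j, m⟩ hp
      rw [Finset.HasAntidiagonal.mem_antidiagonal] at hp
      simp only at hp ⊢
      rcases Nat.eq_zero_or_pos j with rfl | hj
      · have : m = n := by omega
        subst this
        simp [ihc]
      · rw [ih m (by omega)]

/-- Count divided by factorial. -/
noncomputable def qN (n c : ℕ) : ℚ := (NPF (Fin n) c : ℚ) / n.factorial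

theorem qN_rec : RecF qN := by
  intro n c
  rw [Finset.Nat.sum_antidiagonal_eq_sum_range_succ_mk]
  unfold qN
  rw [NPF_rec]
  push_cast
  rw [Finset.sum_div]
  apply Finset.sum_congr rfl
  intro j hj
  have hj' : j ≤ n := by simpa [Nat.lt_succ_iff] using hj
  rw [Nat.cast_choose ℚ hj']
  have := Nat.factorial_ne_zero n
  field_simp

theorem qN_zero (n : ℕ) : qN n 0 = if n = 0 then 1 else 0 := by
  unfold qN
  rw [NPF_zero]
  split_ifs with h <;> simp [h]

/-- Closed form divided by factorial. -/
noncomputable def hN (n c : ℕ) : ℚ :=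
  (((c : ℚ) + n) ^ n - n * ((c : ℚ) + n) ^ (n - 1)) / n.factorial

theorem sum_aux (N : ℚ) (n : ℕ) :
    ∑ m ∈ Finset.range (n + 1), (n.choose m : ℚ) * (m * N ^ (m - 1)) =
      n * (N + 1) ^ (n - 1) := by
  cases n with
  | zero => simp
  | succ n =>
    rw [Finset.sum_range_succ']
    simp only [Nat.add_sub_cancel, Nat.cast_zero, zero_mul, mul_zero, add_zero]
    rw [add_pow, Finset.mul_sum]
    apply Finset.sum_congr rfl
    intro m _
    have := Nat.add_one_mul_choose_eq n m
    have h2 : ((n : ℚ) + 1) * n.choose m = (n + 1).choose (m + 1) * (m + 1) := by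
      exact_mod_cast this
    push_cast
    simp only [one_pow, mul_one]
    linear_combination (-N ^ m) * h2

theorem sum_aux2 (N : ℚ) (n : ℕ) :
    ∑ m ∈ Finset.range (n + 1), (n.choose m : ℚ) * (N ^ m - m * N ^ (m - 1)) =
      (N + 1) ^ n - n * (N + 1) ^ (n - 1) := by
  simp only [mul_sub, Finset.sum_sub_distrib]
  rw [sum_aux, add_pow N 1 n]
  simp [mul_comm]

theorem hN_rec : RecF hN := by
  intro n c
  rw [← Finset.Nat.sum_antidiagonal_swap, Finset.Nat.sum_antidiagonal_eq_sum_range_succ_mk]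
  have h := sum_aux2 ((c : ℚ) + n) n
  have e : hN n (c + 1) = (((c : ℚ) + n + 1) ^ n - n * ((c : ℚ) + n + 1) ^ (n - 1))
      / n.factorial := by
    unfold hN
    push_cast
    rw [show (c : ℚ) + 1 + n = c + n + 1 by ring]
  rw [e, ← h, Finset.sum_div]
  apply Finset.sum_congr rfl
  intro m hm
  have hm' : m ≤ n := by simpa [Nat.lt_succ_iff] using hm
  unfold hN
  simp only [Prod.swap]
  have e2 : ((c + (n - m) : ℕ) : ℚ) + m = c + n := by
    exact_mod_cast (by omega : c + (n - m) + m = c + n)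
  rw [e2, Nat.cast_choose ℚ hm']
  have := Nat.factorial_ne_zero n
  field_simp

theorem hN_zero (n : ℕ) : hN n 0 = if n = 0 then 1 else 0 := by
  unfold hN
  cases n with
  | zero => simp
  | succ n =>
    simp
    left
    ring

theorem qN_eq_hN : ∀ n c, qN n c = hN n c :=
  RecF_unique qN_rec hN_rec (fun n => by rw [qN_zero, hN_zero])

/-- The generating series with slack `c`. -/
noncomputable def QS (c : ℕ) : PowerSeries ℚ := PowerSeries.mk fun n => qN n c

theorem QS_zero : QS 0 = 1 := by
  ext n
  simp [QS, qN_zero, PowerSeries.coeff_one]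

theorem QS_mul (c d : ℕ) : QS c * QS d = QS (c + d) := by
  have hF : RecF (fun n c => PowerSeries.coeff n (QS c * QS d)) := by
    intro n c
    simp only [PowerSeries.coeff_mul, QS, PowerSeries.coeff_mk]
    simp only [qN_rec _ c, Finset.sum_mul, Finset.mul_sum]
    rw [Finset.sum_sigma', Finset.sum_sigma']
    refine Finset.sum_nbij' (fun x => ⟨(x.2.1, x.2.2 + x.1.2), (x.2.2, x.1.2)⟩)
      (fun x => ⟨(x.1.1 + x.2.1, x.2.2), (x.1.1, x.2.1)⟩) ?_ ?_ ?_ ?_ ?_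
    · rintro ⟨⟨a, b⟩, ⟨j, i⟩⟩ h
      simp at h ⊢
      omega
    · rintro ⟨⟨a, b⟩, ⟨j, i⟩⟩ h
      simp at h ⊢
      omega
    · rintro ⟨⟨a, b⟩, ⟨j, i⟩⟩ h
      simp at h ⊢
      omega
    · rintro ⟨⟨a, b⟩, ⟨j, i⟩⟩ h
      simp at h ⊢
      omega
    · rintro ⟨⟨a, b⟩, ⟨j, i⟩⟩ h
      simp only
      ring
  have hG : RecF (fun n c => PowerSeries.coeff n (QS (c + d))) := by
    intro n c
    simp only [QS, PowerSeries.coeff_mk]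
    rw [show c + 1 + d = (c + d) + 1 by ring, qN_rec]
    apply Finset.sum_congr rfl
    intro p _
    rw [show c + d + p.1 = c + p.1 + d by ring]
  ext n
  exact RecF_unique hF hG (fun n => by simp [QS_zero]) n c

theorem QS_pow (c : ℕ) : QS c = QS 1 ^ c := by
  induction c with
  | zero => simp [QS_zero]
  | succ c ih => rw [pow_succ, ← ih, QS_mul]

theorem Pser_eq : Pser = QS 1 := by
  ext n
  simp only [Pser, QS, PowerSeries.coeff_mk, qN_eq_hN, hN]
  congr 1
  cases n with
  | zero => simp
  | succ n =>
    simp only [Nat.add_sub_cancel]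
    push_cast
    ring

/-- `Q_k(x) = P(x)^{k+1}` in `ℚ[[x]]`. -/
theorem stmt13 (k : ℕ) : Qser k = Pser ^ (k + 1) := by
  rw [Pser_eq, ← QS_pow]
  ext n
  simp only [Qser, QS, PowerSeries.coeff_mk, pWith_eq, qN]
end
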